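/- arXiv:2003.12271 — 2 statements merged into one kernel-verified Lean document; each statement's English description precedes it below -/
import Mathlib

section
/- The number of maximal chains in the poset E(P) equals 2^d · e(P), where d = #P and e(P) is the number of linear extensions of P (order-preserving bijections P → {1, 2, …, d}). -/
open Classical

/-- An order filter (upper set) of a poset. -/
def IsOrderFilter {P : Type*} [PartialOrder P] (F : Set P) : Prop :=
  ∀ ⦃u v : P⦄, u ∈ F → u ≤ v → v ∈ F

/-- The support of an integer-valued map. -/
def zsupp {P : Type*} (f : P → ℤ) : Set P := {v | f v ≠ 0}

/-- Membership in `E(P)`. -/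
def IsEF {P : Type*} [PartialOrder P] (f : P → ℤ) : Prop :=
  (∀ v, f v = 1 ∨ f v = 0 ∨ f v = -1) ∧
  IsOrderFilter (zsupp f) ∧
  ∀ v ∈ zsupp f, ¬ Minimal (· ∈ zsupp f) v → f v = 1

/-- The strict relation `f > g` on `E(P)`. -/
def egt {P : Type*} [PartialOrder P] (f g : P → ℤ) : Prop :=
  zsupp g ⊂ zsupp f ∧
  (∀ v ∈ zsupp g, g v ≤ f v) ∧
  ∀ v ∈ zsupp g, Minimal (· ∈ zsupp f) v → f v = g v

/-- The relation `f ≥ g` on `E(P)`. -/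
def ege {P : Type*} [PartialOrder P] (f g : P → ℤ) : Prop := f = g ∨ egt f g

/-- A chain in the poset `E(P)`. -/
def IsEChain {P : Type*} [PartialOrder P] (K : Set (P → ℤ)) : Prop :=
  (∀ f ∈ K, IsEF f) ∧ IsChain ege K

/-- A maximal chain in the poset `E(P)`. -/
def IsMaxEChain {P : Type*} [PartialOrder P] (K : Set (P → ℤ)) : Prop :=
  IsEChain K ∧ ∀ L, IsEChain L → K ⊆ L → K = L

/-- The set of minimal elements of a subset. -/
def minSet {P : Type*} [PartialOrder P] (F : Set P) : Set P := {v | Minimal (· ∈ F) v}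

/-- The signature of a chain in `E(P)`. -/
noncomputable def esgn {P : Type*} [PartialOrder P] (K : Set (P → ℤ)) (v : P) : ℤ :=
  if h : ∃ f ∈ K, Minimal (· ∈ zsupp f) v then h.choose v else 0

/-- The enriched transfer map. -/
noncomputable def ePhi {P : Type*} [PartialOrder P] (f : P → ℤ) : P → ℝ :=
  fun v => if Minimal (· ∈ zsupp f) v then (f v : ℝ) else 0

/-- The simplex `T^e_K` attached to a chain `K` in `E(P)`. -/
noncomputable def Tsimp {P : Type*} [PartialOrder P] (K : Set (P → ℤ)) : Set (P → ℝ) :=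
  convexHull ℝ (ePhi '' K)

/-- Indicator of the set of minimal elements of `F`. -/
noncomputable def chiMin {P : Type*} [PartialOrder P] (F : Set P) : P → ℝ :=
  fun v => if Minimal (· ∈ F) v then 1 else 0

/-- The simplex `T_C` attached to a chain `C` of order filters. -/
noncomputable def TCsimp {P : Type*} [PartialOrder P] (C : Set (Set P)) : Set (P → ℝ) :=
  convexHull ℝ (chiMin '' C)

/-- The sign-change map `R_φ`. -/
def Rmap {P : Type*} (φ : P → ℤ) (g : P → ℝ) : P → ℝ :=
  fun v => if φ v = -1 then -g v else g v

/-- The orthant-type region `V_φ`. -/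
def Vset {P : Type*} (φ : P → ℤ) : Set (P → ℝ) :=
  {g | ∀ v, (φ v = 1 → 0 ≤ g v) ∧ (φ v = 0 → g v = 0) ∧ (φ v = -1 → g v ≤ 0)}

/-- The set `eA(P)` of `±1`-indicator vectors of antichains, inside `ℝ^P`. -/
def eAset (P : Type*) [PartialOrder P] : Set (P → ℝ) :=
  {g | (∀ v, g v = 1 ∨ g v = 0 ∨ g v = -1) ∧ IsAntichain (· ≤ ·) {v | g v ≠ 0}}

/-- The enriched chain polytope `eC(P)`. -/
noncomputable def eChainPolytope (P : Type*) [PartialOrder P] : Set (P → ℝ) :=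
  convexHull ℝ (eAset P)

/-- The chain polytope `C(P)`. -/
noncomputable def chainPolytope (P : Type*) [PartialOrder P] : Set (P → ℝ) :=
  convexHull ℝ {g : P → ℝ | ∃ A : Set P, IsAntichain (· ≤ ·) A ∧
    g = fun v => if v ∈ A then 1 else 0}

/-- The map with support `G` that takes the value `s v` at the minimal elements `v` of `G`
and the value `1` at all other elements of `G`. -/
noncomputable def signedIndicator {P : Type*} [PartialOrder P] (s : P → ℤˣ) (G : Set P) : P → ℤ :=
  fun v => if v ∈ G then (if Minimal (· ∈ G) v then (s v : ℤ) else 1) else 0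

/-- A chain, with respect to inclusion, of upper sets. -/
def IsFilterChain {P : Type*} [PartialOrder P] (C : Set (Set P)) : Prop :=
  (∀ G ∈ C, IsUpperSet G) ∧ IsChain (· ⊆ ·) C

/-- The elements whose label is at least `k`. -/
def labelTail {P : Type*} {n : ℕ} (σ : P → Fin n) (k : ℕ) : Set P := {v | k ≤ (σ v : ℕ)}

/-- All tails of a labelling. -/
def tailChain {P : Type*} {n : ℕ} (σ : P → Fin n) : Set (Set P) := Set.range (labelTail σ)

section Signed

variable {P : Type*} [PartialOrder P]

theorem zsupp_signedIndicator (s : P → ℤˣ) (G : Set P) : zsupp (signedIndicator s G) = G := by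
  ext v
  simp only [zsupp, signedIndicator, Set.mem_ofPred_eq]
  split_ifs <;> simp_all

theorem isEF_signedIndicator (s : P → ℤˣ) {G : Set P} (hG : IsUpperSet G) :
    IsEF (signedIndicator s G) := by
  refine ⟨fun v => ?_, ?_, ?_⟩
  · rcases Int.units_eq_one_or (s v) with h | h <;> simp only [signedIndicator, h] <;>
      split_ifs <;> simp
  · rw [zsupp_signedIndicator]
    exact fun u v hu huv => hG huv hu
  · rw [zsupp_signedIndicator]
    intro v hv hmin
    simp [signedIndicator, hv, hmin]

theorem egt_signedIndicator (s : P → ℤˣ) {G H : Set P} (h : G ⊂ H) :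
    egt (signedIndicator s H) (signedIndicator s G) := by
  have key : ∀ v ∈ G, Minimal (· ∈ H) v → Minimal (· ∈ G) v := fun v hv hm =>
    ⟨hv, fun w hw hwv => hm.2 (h.1 hw) hwv⟩
  refine ⟨by simpa only [zsupp_signedIndicator], ?_, ?_⟩
  · rw [zsupp_signedIndicator]
    intro v hv
    by_cases hm : Minimal (· ∈ H) v
    · simp [signedIndicator, hv, h.1 hv, hm, key v hv hm]
    · rcases Int.units_eq_one_or (s v) with hs | hs <;>
        simp only [signedIndicator, hv, h.1 hv, hm, hs, if_true, if_false] <;> split_ifs <;> simp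
  · rw [zsupp_signedIndicator, zsupp_signedIndicator]
    intro v hv hm
    simp [signedIndicator, hv, h.1 hv, hm, key v hv hm]

theorem isEChain_image_signedIndicator (s : P → ℤˣ) {C : Set (Set P)} (hC : IsFilterChain C) :
    IsEChain (signedIndicator s '' C) := by
  refine ⟨?_, ?_⟩
  · rintro _ ⟨G, hG, rfl⟩
    exact isEF_signedIndicator s (hC.1 G hG)
  · rintro _ ⟨G, hG, rfl⟩ _ ⟨H, hH, rfl⟩ hne
    have hGH : G ≠ H := fun h => hne (h ▸ rfl)
    rcases hC.2 hG hH hGH with h | h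
    · exact Or.inr (Or.inr (egt_signedIndicator s (h.ssubset_of_ne hGH)))
    · exact Or.inl (Or.inr (egt_signedIndicator s (h.ssubset_of_ne hGH.symm)))

theorem zsupp_image_signedIndicator (s : P → ℤˣ) (C : Set (Set P)) :
    zsupp '' (signedIndicator s '' C) = C := by
  simp [Set.image_image, zsupp_signedIndicator]

theorem IsEChain.injOn_zsupp {K : Set (P → ℤ)} (hK : IsEChain K) : Set.InjOn zsupp K := by
  intro f hf g hg h
  by_contra hne
  rcases hK.2 hf hg hne with (h' | h') | (h' | h')
  · exact hne h'
  · exact h'.1.ne h.symm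
  · exact hne h'.symm
  · exact h'.1.ne h

theorem IsEChain.isFilterChain_zsupp {K : Set (P → ℤ)} (hK : IsEChain K) :
    IsFilterChain (zsupp '' K) := by
  refine ⟨?_, ?_⟩
  · rintro _ ⟨f, hf, rfl⟩
    exact fun u v huv hu => (hK.1 f hf).2.1 hu huv
  · rintro _ ⟨f, hf, rfl⟩ _ ⟨g, hg, rfl⟩ hne
    rcases hK.2 hf hg (fun h => hne (h ▸ rfl)) with (h' | h') | (h' | h')
    · exact absurd (h' ▸ rfl) hne
    · exact Or.inr h'.1.1
    · exact absurd (h' ▸ rfl) hne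
    · exact Or.inl h'.1.1

theorem IsEChain.eq_of_minimal {K : Set (P → ℤ)} (hK : IsEChain K) {f g : P → ℤ} (hf : f ∈ K)
    (hg : g ∈ K) {v : P} (hfv : Minimal (· ∈ zsupp f) v) (hgv : Minimal (· ∈ zsupp g) v) :
    f v = g v := by
  by_cases hne : f = g
  · rw [hne]
  rcases hK.2 hf hg hne with (h | h) | (h | h)
  · rw [h]
  · exact h.2.2 v hgv.1 hfv
  · rw [h]
  · exact (h.2.2 v hfv.1 hgv).symm

theorem IsEChain.exists_sign {K : Set (P → ℤ)} (hK : IsEChain K) :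
    ∃ s : P → ℤˣ, signedIndicator s '' (zsupp '' K) = K := by
  have h : ∀ v, ∃ e : ℤˣ, ∀ f ∈ K, Minimal (· ∈ zsupp f) v → f v = e := by
    intro v
    by_cases hex : ∃ f ∈ K, Minimal (· ∈ zsupp f) v
    · obtain ⟨f, hf, hfv⟩ := hex
      rcases (hK.1 f hf).1 v with h | h | h
      · exact ⟨1, fun g hg hgv => by rw [hK.eq_of_minimal hg hf hgv hfv, h]; rfl⟩
      · exact absurd h hfv.1
      · exact ⟨-1, fun g hg hgv => by rw [hK.eq_of_minimal hg hf hgv hfv, h]; rfl⟩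
    · exact ⟨1, fun f hf hfv => absurd ⟨f, hf, hfv⟩ hex⟩
  choose s hs using h
  refine ⟨s, ?_⟩
  have heq : ∀ f ∈ K, signedIndicator s (zsupp f) = f := by
    intro f hf
    funext v
    simp only [signedIndicator]
    split_ifs with h1 h2
    · exact (hs v f hf h2).symm
    · exact ((hK.1 f hf).2.2 v h1 h2).symm
    · exact (not_not.mp h1).symm
  rw [Set.image_image, Set.image_congr heq, Set.image_id']

theorem IsMaxEChain.exists_eq {K : Set (P → ℤ)} (hK : IsMaxEChain K) :
    ∃ (s : P → ℤˣ) (C : Set (Set P)), Maximal IsFilterChain C ∧ signedIndicator s '' C = K := by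
  obtain ⟨s, hs⟩ := hK.1.exists_sign
  refine ⟨s, _, ⟨hK.1.isFilterChain_zsupp, fun D hD hCD => ?_⟩, hs⟩
  have h := hK.2 _ (isEChain_image_signedIndicator s hD) (hs ▸ Set.image_mono hCD)
  rw [h, zsupp_image_signedIndicator]

theorem isMaxEChain_image_signedIndicator (s : P → ℤˣ) {C : Set (Set P)}
    (hC : Maximal IsFilterChain C) : IsMaxEChain (signedIndicator s '' C) := by
  refine ⟨isEChain_image_signedIndicator s hC.1, fun L hL hKL => hKL.antisymm fun f hf => ?_⟩
  have hCL : C ⊆ zsupp '' L := by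
    rw [← zsupp_image_signedIndicator s C]
    exact Set.image_mono hKL
  have hfC : zsupp f ∈ C := hC.2 hL.isFilterChain_zsupp hCL ⟨f, hf, rfl⟩
  have hmem : signedIndicator s (zsupp f) ∈ signedIndicator s '' C := ⟨_, hfC, rfl⟩
  rwa [← hL.injOn_zsupp (hKL hmem) hf (zsupp_signedIndicator s _)]

end Signed

section Tails

variable {P : Type*} {n : ℕ}

theorem label_le_iff (σ : P → Fin n) (u v : P) :
    σ u ≤ σ v ↔ ∀ G ∈ tailChain σ, u ∈ G → v ∈ G := by
  constructor
  · rintro h _ ⟨k, rfl⟩ hu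
    exact (show k ≤ _ from hu).trans h
  · intro h
    exact h _ ⟨σ u, rfl⟩ (le_refl (σ u : ℕ))

theorem eq_of_tailChain_eq {σ τ : P → Fin n} (hσ : Function.Bijective σ)
    (hτ : Function.Bijective τ) (h : tailChain σ = tailChain τ) : σ = τ := by
  have hle : ∀ u v, σ u ≤ σ v ↔ τ u ≤ τ v := fun u v => by
    rw [label_le_iff, label_le_iff, h]
  let e : Fin n ≃o Fin n :=
    { toEquiv := (Equiv.ofBijective σ hσ).symm.trans (Equiv.ofBijective τ hτ)
      map_rel_iff' := by
        intro a b
        obtain ⟨u, rfl⟩ := hσ.2 a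
        obtain ⟨v, rfl⟩ := hσ.2 b
        simp [hle] }
  funext v
  have hv : e (σ v) = τ v := by simp [e]
  rw [← hv, Subsingleton.elim e (OrderIso.refl _)]
  rfl

theorem mem_tailChain_of_forall_label_le [Finite P] {σ : P → Fin n} {G : Set P}
    (h : ∀ v ∈ G, (∀ w ∈ G, σ v ≤ σ w) → ∀ w, σ v ≤ σ w → w ∈ G) : G ∈ tailChain σ := by
  rcases G.eq_empty_or_nonempty with rfl | hne
  · exact ⟨n, Set.eq_empty_of_forall_notMem fun v hv => (σ v).2.not_ge hv⟩
  · obtain ⟨v, hv, hmin⟩ := Set.exists_min_image G σ G.toFinite hne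
    exact ⟨σ v, Set.Subset.antisymm (fun w hw => h v hv hmin w hw) fun w hw => hmin w hw⟩

variable [PartialOrder P]

theorem isFilterChain_tailChain {σ : P → Fin n} (hσ : Monotone σ) :
    IsFilterChain (tailChain σ) := by
  refine ⟨?_, ?_⟩
  · rintro _ ⟨k, rfl⟩ u v huv hu
    exact (show k ≤ _ from hu).trans (hσ huv)
  · rintro _ ⟨k, rfl⟩ _ ⟨l, rfl⟩ -
    rcases le_total k l with h | h
    · exact Or.inr fun v hv => le_trans h hv
    · exact Or.inl fun v hv => le_trans h hv

theorem maximal_tailChain [Finite P] {σ : P → Fin n} (hσ : Monotone σ)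
    (hinj : Function.Injective σ) : Maximal IsFilterChain (tailChain σ) := by
  refine ⟨isFilterChain_tailChain hσ, fun D hD hsub G hG => ?_⟩
  refine mem_tailChain_of_forall_label_le fun v hv hmin w hw => ?_
  rcases hw.eq_or_lt with h | h
  · rwa [← hinj h]
  rcases hD.2.total hG (hsub ⟨σ v + 1, rfl⟩) with h' | h'
  · exact absurd (h' hv) (Nat.not_succ_le_self _)
  · exact h' (Nat.succ_le_of_lt h)

theorem minimal_labelTail {σ : P → Fin n} (hσ : Monotone σ) (hinj : Function.Injective σ) (v : P) :
    Minimal (· ∈ labelTail σ (σ v)) v :=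
  ⟨le_refl (σ v : ℕ), fun _ hw hwv => (hinj (le_antisymm hw (hσ hwv))).le⟩

/-- A maximal chain of filters contains the union of `Set.Ici v` with the members avoiding `v`. -/
theorem sUnion_union_Ici_mem {C : Set (Set P)} (hC : Maximal IsFilterChain C) (v : P) :
    ⋃₀ {G ∈ C | v ∉ G} ∪ Set.Ici v ∈ C := by
  have hup : IsUpperSet (⋃₀ {G ∈ C | v ∉ G} ∪ Set.Ici v) :=
    (isUpperSet_sUnion fun G hG => hC.1.1 G hG.1).union (isUpperSet_Ici v)
  refine hC.2 (y := insert _ C) ⟨?_, hC.1.2.insert fun G hG _ => ?_⟩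
    (Set.subset_insert _ _) (Set.mem_insert _ _)
  · rintro G (rfl | hG)
    · exact hup
    · exact hC.1.1 G hG
  · by_cases hv : v ∈ G
    · refine Or.inl (Set.union_subset (Set.sUnion_subset fun H hH => ?_) fun w hw =>
        hC.1.1 G hG hw hv)
      exact (hC.1.2.total hH.1 hG).resolve_right fun h => hH.2 (h hv)
    · exact Or.inr fun w hw => Or.inl ⟨G, ⟨hG, hv⟩, hw⟩

theorem le_of_forall_mem_iff {C : Set (Set P)} (hC : Maximal IsFilterChain C) {u v : P}
    (h : ∀ G ∈ C, u ∈ G ↔ v ∈ G) : v ≤ u := by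
  rcases (h _ (sUnion_union_Ici_mem hC v)).2 (Or.inr le_rfl) with ⟨G, hG, hu⟩ | hu
  · exact absurd ((h G hG.1).1 hu) hG.2
  · exact hu

end Tails

theorem exists_bijective_label {α : Type*} [Fintype α] (r : α → α → Prop) (hrefl : ∀ a, r a a)
    (htrans : ∀ a b c, r a b → r b c → r a c) (hanti : ∀ a b, r a b → r b a → a = b)
    (htotal : ∀ a b, r a b ∨ r b a) :
    ∃ σ : α → Fin (Fintype.card α), Function.Bijective σ ∧ ∀ a b, σ a ≤ σ b ↔ r a b := by
  let _ : LinearOrder α :=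
    { le := r
      le_refl := hrefl
      le_trans := htrans
      le_antisymm := hanti
      le_total := htotal
      toDecidableLE := Classical.decRel _ }
  let e := (Fintype.orderIsoFinOfCardEq α rfl).symm
  exact ⟨e, e.bijective, fun a b => e.le_iff_le⟩

theorem exists_tailChain_eq {P : Type*} [Fintype P] [PartialOrder P] {C : Set (Set P)}
    (hC : Maximal IsFilterChain C) :
    ∃ σ : P → Fin (Fintype.card P), (Function.Bijective σ ∧ Monotone σ) ∧ tailChain σ = C := by
  obtain ⟨σ, hbij, hσ⟩ := exists_bijective_label (fun u v : P => ∀ G ∈ C, u ∈ G → v ∈ G)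
    (fun _ _ _ h => h) (fun _ _ _ h₁ h₂ G hG hu => h₂ G hG (h₁ G hG hu))
    (fun u v h₁ h₂ => le_antisymm
      (le_of_forall_mem_iff hC fun G hG => ⟨h₂ G hG, h₁ G hG⟩)
      (le_of_forall_mem_iff hC fun G hG => ⟨h₁ G hG, h₂ G hG⟩))
    (fun u v => by
      by_contra! h
      obtain ⟨⟨G, hG, huG, hvG⟩, H, hH, hvH, huH⟩ := h
      rcases hC.1.2.total hG hH with h | h
      · exact huH (h huG)
      · exact hvG (h hvH))
  have hmono : Monotone σ := fun u v huv => (hσ u v).2 fun G hG hu => hC.1.1 G hG huv hu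
  refine ⟨σ, ⟨hbij, hmono⟩, (hC.eq_of_subset (isFilterChain_tailChain hmono) ?_).symm⟩
  exact fun G hG => mem_tailChain_of_forall_label_le fun v hv _ w hw => (hσ v w).1 hw G hG hv

theorem bijOn_signedIndicator_tailChain {P : Type*} [Fintype P] [PartialOrder P] :
    Set.BijOn (fun p : (P → ℤˣ) × (P → Fin (Fintype.card P)) =>
        signedIndicator p.1 '' tailChain p.2)
      (Set.univ ×ˢ {σ | Function.Bijective σ ∧ Monotone σ}) {K | IsMaxEChain K} := by
  refine ⟨?_, ?_, ?_⟩
  · rintro ⟨s, σ⟩ ⟨-, hσ⟩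
    exact isMaxEChain_image_signedIndicator s (maximal_tailChain hσ.2 hσ.1.1)
  · rintro ⟨s, σ⟩ ⟨-, hσ⟩ ⟨t, τ⟩ ⟨-, hτ⟩ h
    dsimp only at h hσ hτ
    have hC : tailChain σ = tailChain τ := by
      rw [← zsupp_image_signedIndicator s (tailChain σ), h, zsupp_image_signedIndicator]
    obtain rfl := eq_of_tailChain_eq hσ.1 hτ.1 hC
    have hst : s = t := by
      funext v
      have hv := minimal_labelTail hσ.2 hσ.1.1 v
      obtain ⟨G, hG, hGv⟩ : signedIndicator s (labelTail σ (σ v)) ∈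
          signedIndicator t '' tailChain σ := h ▸ ⟨_, ⟨_, rfl⟩, rfl⟩
      obtain rfl : G = labelTail σ (σ v) := by
        rw [← zsupp_signedIndicator t G, hGv, zsupp_signedIndicator]
      have := congrFun hGv v
      simp only [signedIndicator, hv.1, hv, if_true] at this
      exact (Units.ext this).symm
    rw [hst]
  · intro K hK
    obtain ⟨s, C, hC, rfl⟩ := IsMaxEChain.exists_eq hK
    obtain ⟨σ, hσ, rfl⟩ := exists_tailChain_eq hC
    exact ⟨(s, σ), ⟨trivial, hσ⟩, rfl⟩

theorem stmt10 {P : Type*} [Fintype P] [PartialOrder P] :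
    {K : Set (P → ℤ) | IsMaxEChain K}.ncard =
      2 ^ Fintype.card P *
        {σ : P → Fin (Fintype.card P) | Function.Bijective σ ∧ Monotone σ}.ncard := by
  rw [← bijOn_signedIndicator_tailChain.image_eq,
    bijOn_signedIndicator_tailChain.injOn.ncard_image, Set.ncard_prod,
    Set.ncard_univ, Nat.card_eq_fintype_card, Fintype.card_fun, Fintype.card_units_int]
end

section
/- For every chain K in the poset E(P) one has T^e_K = R_{sgn(K)}(T_{supp(K)}). -/
open Classical

/-- Two members of a chain in `E(P)` agree where both supports have a common minimal element. -/
theorem IsEChain.apply_eq_of_minimal {P : Type*} [PartialOrder P] {K : Set (P → ℤ)}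
    (hK : IsEChain K) {f g : P → ℤ} (hf : f ∈ K) (hg : g ∈ K) {v : P}
    (hvf : Minimal (· ∈ zsupp f) v) (hvg : Minimal (· ∈ zsupp g) v) : f v = g v := by
  by_cases hfg : f = g
  · rw [hfg]
  rcases hK.2 hf hg hfg with (h | h) | (h | h)
  · rw [h]
  · exact h.2.2 v hvg.prop hvf
  · rw [h]
  · exact (h.2.2 v hvf.prop hvg).symm

theorem IsEChain.esgn_eq {P : Type*} [PartialOrder P] {K : Set (P → ℤ)}
    (hK : IsEChain K) {f : P → ℤ} (hf : f ∈ K) {v : P}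
    (hv : Minimal (· ∈ zsupp f) v) : esgn K v = f v := by
  have h : ∃ f ∈ K, Minimal (· ∈ zsupp f) v := ⟨f, hf, hv⟩
  rw [esgn, dif_pos h]
  exact hK.apply_eq_of_minimal h.choose_spec.1 hf h.choose_spec.2 hv

theorem IsEChain.ePhi_eq_Rmap_chiMin {P : Type*} [PartialOrder P] {K : Set (P → ℤ)}
    (hK : IsEChain K) {f : P → ℤ} (hf : f ∈ K) :
    ePhi f = Rmap (esgn K) (chiMin (zsupp f)) := by
  funext v
  by_cases hv : Minimal (· ∈ zsupp f) v
  · have hne : f v ≠ 0 := hv.prop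
    rcases (hK.1 f hf).1 v with h | h | h
    · simp [ePhi, Rmap, chiMin, hv, hK.esgn_eq hf hv, h]
    · exact absurd h hne
    · simp [ePhi, Rmap, chiMin, hv, hK.esgn_eq hf hv, h]
  · simp [ePhi, Rmap, chiMin, hv]

theorem isLinearMap_Rmap {P : Type*} (φ : P → ℤ) : IsLinearMap ℝ (Rmap φ) where
  map_add x y := by
    funext v
    by_cases h : φ v = -1 <;> simp [Rmap, h, add_comm]
  map_smul c x := by
    funext v
    by_cases h : φ v = -1 <;> simp [Rmap, h]

theorem stmt13 {P : Type*} [Fintype P] [PartialOrder P] {K : Set (P → ℤ)}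
    (hK : IsEChain K) :
    Tsimp K = Rmap (esgn K) '' TCsimp (zsupp '' K) := by
  rw [Tsimp, TCsimp, (isLinearMap_Rmap _).image_convexHull, Set.image_image, Set.image_image]
  exact congrArg _ (Set.image_congr fun f hf => hK.ePhi_eq_Rmap_chiMin hf)
end
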